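/- Let T be a balanced spanning tree of the tree connection game of height h whose degree sequence is (0, 1, 2, 4, d_{h−4}, …, d_0), i.e., d_h = 0, d_{h−1} = 1, d_{h−2} = 2, d_{h−3} = 4, and suppose d_{j+1} < d_j ≤ 2·d_{j+1} + 1 for every j ≤ h − 4. Then T is stable, i.e., the corresponding strategy profile is a pure Nash equilibrium. Consequently, the tree connection game admits a pure Nash equilibrium for infinitely many numbers of agents n. -/

import Mathlib

open Function
open scoped ENNReal Classical

noncomputable section

namespace TCG

variable {n : ℕ}

/-- In-degree of node `v` in the network induced by profile `s` with root `r`: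
the number of activated edges `(u, v)` with `u` an agent (a non-root node). -/
def indeg (r : Fin (n + 1)) (s : Fin (n + 1) → Fin (n + 1)) (v : Fin (n + 1)) : ℕ :=
  Nat.card {u : Fin (n + 1) | u ≠ r ∧ s u = v}

/-- `|T(u)|`: the number of nodes having a directed path to `u` (including `u` itself). -/
def subtreeSize (s : Fin (n + 1) → Fin (n + 1)) (u : Fin (n + 1)) : ℕ :=
  Nat.card {w : Fin (n + 1) | ∃ k, s^[k] w = u}

/-- Cost of the agent at node `v` with respect to the root `r`:
the sum, over the edges `(u, u')` of the unique directed path from `v` to `r`,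
of `indeg(u') / |T(u)|`; the cost is `∞` if no such path exists. -/
def cost (r : Fin (n + 1)) (s : Fin (n + 1) → Fin (n + 1)) (v : Fin (n + 1)) : ℝ≥0∞ :=
  if h : ∃ k, s^[k] v = r then
    ∑ k ∈ Finset.range (Nat.find h),
      (indeg r s (s^[k + 1] v) : ℝ≥0∞) / (subtreeSize s (s^[k] v) : ℝ≥0∞)
  else ⊤

/-- A valid strategy profile: the root is absorbing (a formal convention encoding that the
root activates no edge), and every agent chooses a node different from herself. -/
def ValidProfile (r : Fin (n + 1)) (s : Fin (n + 1) → Fin (n + 1)) : Prop :=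
  s r = r ∧ ∀ v, v ≠ r → s v ≠ v

/-- Pure Nash equilibrium (the induced network is *stable*): no agent can strictly
decrease her cost by unilaterally switching her activated edge to another node. -/
def IsStable (r : Fin (n + 1)) (s : Fin (n + 1) → Fin (n + 1)) : Prop :=
  ValidProfile r s ∧
    ∀ v, v ≠ r → ∀ w, w ≠ v → cost r s v ≤ cost r (Function.update s v w) v

/-- Social cost: the sum of the costs of all agents (the non-root nodes). -/
def SC (s : Fin (n + 1) → Fin (n + 1)) : ℝ≥0∞ :=
  ∑ v ∈ Finset.univ.erase (0 : Fin (n + 1)), cost 0 s v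

/-- Height of the induced network: the maximum length of a (leaf-to-)root path,
i.e. the least `k` such that every node arrives at the root after `k` steps. -/
def height (s : Fin (n + 1) → Fin (n + 1)) : ℕ :=
  sInf {k | ∀ v, s^[k] v = 0}

/-- Fairness Ratio: maximum agent cost divided by minimum agent cost. -/
def FR (s : Fin (n + 1) → Fin (n + 1)) : ℝ≥0∞ :=
  (⨆ (v : Fin (n + 1)) (_ : v ≠ 0), cost 0 s v) /
    (⨅ (v : Fin (n + 1)) (_ : v ≠ 0), cost 0 s v)

/-- The degrees `d i` and subtree sizes `N i` at distance `i` from the root in a balanced tree of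
height `H + 3` with degree sequence `(0, 1, 2, 4, d (H - 1), …, d 0)`. -/
structure BalancedSequence (H : ℕ) (d N : ℕ → ℝ) : Prop where
  deg_bot : d (H + 3) = 0
  deg_one : d (H + 2) = 1
  deg_two : d (H + 1) = 2
  deg_three : d H = 4
  deg_lt' : ∀ i < H, d (i + 1) + 1 ≤ d i
  deg_le' : ∀ i < H, d i ≤ 2 * d (i + 1) + 1
  size_bot : N (H + 3) = 1
  size_eq : ∀ i < H + 3, N i = 1 + d i * N (i + 1)

namespace BalancedSequence

variable {H : ℕ} {d N : ℕ → ℝ}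

lemma size_one (hB : BalancedSequence H d N) : N (H + 2) = 2 := by
  rw [hB.size_eq _ (by omega), hB.deg_one, hB.size_bot]; norm_num

lemma size_two (hB : BalancedSequence H d N) : N (H + 1) = 5 := by
  rw [hB.size_eq _ (by omega), hB.deg_two, hB.size_one]; norm_num

lemma size_three (hB : BalancedSequence H d N) : N H = 21 := by
  rw [hB.size_eq _ (by omega), hB.deg_three, hB.size_two]; norm_num

lemma deg_lt (hB : BalancedSequence H d N) {i : ℕ} (hi : i < H + 3) : d (i + 1) + 1 ≤ d i := by
  obtain h | rfl | rfl | rfl : i < H ∨ i = H ∨ i = H + 1 ∨ i = H + 2 := by omega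
  · exact hB.deg_lt' i h
  · rw [hB.deg_two, hB.deg_three]; norm_num
  · rw [hB.deg_one, hB.deg_two]; norm_num
  · rw [hB.deg_bot, hB.deg_one]; norm_num

lemma deg_antitone (hB : BalancedSequence H d N) {i j : ℕ} (hij : i ≤ j) (hj : j ≤ H + 3) :
    d j + (j - i) ≤ d i := by
  induction j, hij using Nat.le_induction with
  | base => simp
  | succ j hij ih =>
    have := ih (by omega)
    have := hB.deg_lt (i := j) (by omega)
    push_cast
    linarith

lemma one_le_deg (hB : BalancedSequence H d N) {i : ℕ} (hi : i < H + 3) : 1 ≤ d i := by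
  have h := hB.deg_antitone (show i ≤ H + 2 by omega) (by omega)
  have : (i : ℝ) ≤ (H + 2 : ℕ) := by exact_mod_cast (by omega : i ≤ H + 2)
  rw [hB.deg_one] at h
  linarith

lemma deg_nonneg (hB : BalancedSequence H d N) {i : ℕ} (hi : i ≤ H + 3) : 0 ≤ d i := by
  obtain rfl | h := hi.eq_or_lt
  · exact hB.deg_bot.ge
  · linarith [hB.one_le_deg h]

lemma five_le_deg (hB : BalancedSequence H d N) {i : ℕ} (hi : i < H) : 5 ≤ d i := by
  have h := hB.deg_antitone hi.le (by omega)
  have : (i : ℝ) + 1 ≤ H := by exact_mod_cast hi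
  rw [hB.deg_three] at h
  linarith

lemma one_le_size (hB : BalancedSequence H d N) {i : ℕ} (hi : i ≤ H + 3) : 1 ≤ N i := by
  induction hi using Nat.decreasingInduction with
  | self => exact hB.size_bot.ge
  | of_succ i hi ih =>
    rw [hB.size_eq i hi]
    have := mul_nonneg (hB.deg_nonneg hi.le) (zero_le_one.trans ih)
    linarith

lemma size_succ_le (hB : BalancedSequence H d N) {i : ℕ} (hi : i < H + 3) :
    d i * N (i + 1) ≤ N i := by
  rw [hB.size_eq i hi]; linarith

lemma size_antitone (hB : BalancedSequence H d N) {i j : ℕ} (hij : i ≤ j) (hj : j ≤ H + 3) :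
    N j ≤ N i := by
  induction j, hij using Nat.le_induction with
  | base => simp
  | succ j hij ih =>
    have h1 := ih (by omega)
    have h2 := hB.size_succ_le (i := j) (by omega)
    have h3 := hB.one_le_deg (i := j) (by omega)
    have h4 := hB.one_le_size hj
    nlinarith

lemma sum_deg_div_sq_le (hB : BalancedSequence H d N) {j : ℕ} (hj : j < H) :
    ∑ i ∈ Finset.range j, d i / N (i + 1) ^ 2 ≤ 5 / 2 / (N j * N (j + 1)) := by
  induction j with
  | zero =>
    have h1 := hB.one_le_size (i := 0) (by omega)
    have h2 := hB.one_le_size (i := 0 + 1) (by omega)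
    rw [Finset.sum_range_zero]
    positivity
  | succ j ih =>
    rw [Finset.sum_range_succ]
    have h0 := ih (by omega)
    have n0 := hB.one_le_size (i := j) (by omega)
    have n1 := hB.one_le_size (i := j + 1) (by omega)
    have n2 := hB.one_le_size (i := j + 1 + 1) (by omega)
    have s0 := hB.size_succ_le (i := j) (by omega)
    have s1 := hB.size_succ_le (i := j + 1) (by omega)
    have e0 := hB.five_le_deg (i := j) (by omega)
    have e1 := hB.five_le_deg (i := j + 1) hj
    have l0 := hB.deg_le' j (by omega)
    have key1 : 5 / 2 / (N j * N (j + 1)) ≤ 1 / 10 / (N (j + 1) * N (j + 1 + 1)) := by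
      rw [div_le_div_iff₀ (by positivity) (by positivity)]
      have : 25 * N (j + 1 + 1) ≤ N j := by nlinarith
      nlinarith
    have key2 : d j / N (j + 1) ^ 2 ≤ 11 / 5 / (N (j + 1) * N (j + 1 + 1)) := by
      rw [div_le_div_iff₀ (by positivity) (by positivity)]
      have : d j * N (j + 1 + 1) ≤ 11 / 5 * N (j + 1) := by nlinarith
      nlinarith
    calc _ ≤ _ := add_le_add (h0.trans key1) key2
      _ = 23 / 10 / (N (j + 1) * N (j + 1 + 1)) := by ring
      _ ≤ _ := by gcongr ?_ / _; norm_num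

lemma sum_deg_div_le_sq (hB : BalancedSequence H d N) {j : ℕ} (hj : j ≤ H + 3) {c : ℝ}
    (hc : 0 ≤ c) :
    ∑ i ∈ Finset.range j, d i / (N (i + 1) * (N (i + 1) + c)) ≤
      ∑ i ∈ Finset.range j, d i / N (i + 1) ^ 2 := by
  refine Finset.sum_le_sum fun i hi => ?_
  rw [Finset.mem_range] at hi
  have n1 := hB.one_le_size (i := i + 1) (by omega)
  have := hB.deg_nonneg (i := i) (by omega)
  gcongr
  nlinarith

lemma sum_deg_div_top_le (hB : BalancedSequence H d N) {c : ℝ} (hc : 0 ≤ c) :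
    ∑ i ∈ Finset.range H, d i / (N (i + 1) * (N (i + 1) + c)) ≤
      9 / (21 * (21 + c)) + 1 / 800 := by
  obtain _ | j := H
  · rw [Finset.sum_range_zero]
    positivity
  · rw [Finset.sum_range_succ, hB.size_three, add_comm]
    have h1 := (hB.sum_deg_div_le_sq (j := j) (by omega) hc).trans
      (hB.sum_deg_div_sq_le (by omega))
    have h2 := hB.deg_le' j (by omega)
    have h3 := hB.five_le_deg (i := j) (by omega)
    have h4 := hB.size_succ_le (i := j) (by omega)
    rw [hB.size_three] at h1 h4
    rw [hB.deg_three] at h2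
    have h5 : 105 ≤ N j := by linarith
    have h6 : 5 / 2 / (N j * 21) ≤ 1 / 800 := by
      rw [div_le_div_iff₀ (by positivity) (by norm_num)]
      linarith
    have h7 : d j / (21 * (21 + c)) ≤ 9 / (21 * (21 + c)) := by
      gcongr; linarith
    linarith

/-- The amount by which the costs on the path above `k + 1` drop when every subtree size
is increased by `N (k + 1)`. -/
def pathGain (d N : ℕ → ℝ) (k : ℕ) : ℝ :=
  ∑ i ∈ Finset.range k, (d i / N (i + 1) - d i / (N (i + 1) + N (k + 1)))

lemma size_mul_pathGain (hB : BalancedSequence H d N) {k : ℕ} (hk : k < H + 3) :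
    N (k + 1) * pathGain d N k = N (k + 1) ^ 2 *
      ∑ i ∈ Finset.range k, d i / (N (i + 1) * (N (i + 1) + N (k + 1))) := by
  rw [pathGain, Finset.mul_sum, Finset.mul_sum]
  refine Finset.sum_congr rfl fun i hi => ?_
  rw [Finset.mem_range] at hi
  have n1 := hB.one_le_size (i := i + 1) (by omega)
  have n2 := hB.one_le_size (i := k + 1) (by omega)
  field_simp
  ring

lemma pathGain_of_lt (hB : BalancedSequence H d N) {k : ℕ} (hk : k < H) :
    N (k + 1) * pathGain d N k ≤ 1 / 2 := by
  have n1 := hB.one_le_size (i := k + 1) (by omega)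
  have n0 := hB.one_le_size (i := k) (by omega)
  rw [hB.size_mul_pathGain (by omega)]
  have h1 := (hB.sum_deg_div_le_sq (j := k) (c := N (k + 1)) (by omega) (by linarith)).trans
    (hB.sum_deg_div_sq_le hk)
  have h3 := hB.five_le_deg hk
  have h4 := hB.size_succ_le (i := k) (by omega)
  calc _ ≤ N (k + 1) ^ 2 * (5 / 2 / (N k * N (k + 1))) := by gcongr
    _ = 5 / 2 * N (k + 1) / N k := by field_simp
    _ ≤ 1 / 2 := by
      rw [div_le_iff₀ (by positivity)]
      nlinarith

lemma pathGain_three (hB : BalancedSequence H d N) :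
    N (H + 1) * pathGain d N H ≤ 1 := by
  rw [hB.size_mul_pathGain (by omega), hB.size_two]
  linarith [hB.sum_deg_div_top_le (c := 5) (by norm_num)]

lemma pathGain_two (hB : BalancedSequence H d N) :
    N (H + 2) * pathGain d N (H + 1) ≤ 2 / 3 := by
  rw [hB.size_mul_pathGain (by omega), hB.size_one, Finset.sum_range_succ, hB.size_two,
    hB.deg_three]
  linarith [hB.sum_deg_div_top_le (c := 2) (by norm_num)]

lemma pathGain_one (hB : BalancedSequence H d N) :
    N (H + 3) * pathGain d N (H + 2) ≤ 1 / 2 := by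
  rw [hB.size_mul_pathGain (by omega), hB.size_bot, Finset.sum_range_succ, Finset.sum_range_succ,
    hB.size_two, hB.size_one, hB.deg_three, hB.deg_two]
  linarith [hB.sum_deg_div_top_le (c := 1) (by norm_num)]

/-- A lower bound for the cost of an agent at distance `k` from the root after she moves
below a node at distance `m`. -/
def moveCost (d N : ℕ → ℝ) (k m : ℕ) : ℝ :=
  (d m + 1) / N k + ∑ i ∈ Finset.range m, d i / (N (i + 1) + N k)

lemma moveCost_succ (k m : ℕ) : moveCost d N k (m + 1) =
    moveCost d N k m - (d m - d (m + 1)) / N k + d m / (N (m + 1) + N k) := by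
  rw [moveCost, moveCost, Finset.sum_range_succ]
  ring

lemma moveCost_succ_le (hB : BalancedSequence H d N) {k m : ℕ} (hm : m + 1 < k) (hk : k ≤ H + 3) :
    moveCost d N k (m + 1) ≤ moveCost d N k m := by
  rw [moveCost_succ]
  have n1 := hB.one_le_size (i := m + 1) (by omega)
  have n2 := hB.one_le_size hk
  have h1 := hB.size_succ_le (i := m + 1) (by omega)
  have h2 := hB.size_antitone (i := m + 1 + 1) (by omega) hk
  have h3 := hB.deg_lt (i := m) (by omega)
  have h4 := hB.deg_nonneg (i := m + 1) (by omega)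
  have : d m / (N (m + 1) + N k) ≤ (d m - d (m + 1)) / N k := by
    rw [div_le_div_iff₀ (by positivity) (by positivity)]
    have h5 : (d (m + 1) + 1) * N k ≤ N (m + 1) + N k := by nlinarith
    have h6 : d m ≤ (d m - d (m + 1)) * (d (m + 1) + 1) := by nlinarith
    calc _ ≤ (d m - d (m + 1)) * (d (m + 1) + 1) * N k := by gcongr
      _ = (d m - d (m + 1)) * ((d (m + 1) + 1) * N k) := by ring
      _ ≤ _ := by
        gcongr
        linarith
  linarith

lemma moveCost_le_succ (hB : BalancedSequence H d N) {k m : ℕ} (hm : k ≤ m) (hm' : m < H + 2) :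
    moveCost d N k m ≤ moveCost d N k (m + 1) := by
  rw [moveCost_succ]
  have n1 := hB.one_le_size (i := m + 1) (by omega)
  have n2 := hB.one_le_size (i := k) (by omega)
  have h1 := hB.size_succ_le (i := m) (by omega)
  have h2 := hB.size_antitone hm (by omega)
  have h3 := hB.one_le_deg (i := m + 1) (by omega)
  have : (d m - d (m + 1)) / N k ≤ d m / (N (m + 1) + N k) := by
    rw [div_le_div_iff₀ (by positivity) (by positivity)]
    nlinarith
  linarith

lemma moveCost_le_of_lt (hB : BalancedSequence H d N) {k m : ℕ} (hm : m ≤ k) (hk : k < H + 3) :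
    moveCost d N (k + 1) k ≤ moveCost d N (k + 1) m := by
  induction hm using Nat.decreasingInduction with
  | self => exact le_rfl
  | of_succ m hm ih => exact ih.trans (hB.moveCost_succ_le (by omega) (by omega))

lemma moveCost_le_of_le (hB : BalancedSequence H d N) {k m : ℕ} (hm : k ≤ m) (hm' : m ≤ H + 2) :
    moveCost d N k k ≤ moveCost d N k m := by
  induction m, hm using Nat.le_induction with
  | base => exact le_rfl
  | succ m hm ih => exact (ih (by omega)).trans (hB.moveCost_le_succ hm (by omega))

lemma moveCost_self_le (hB : BalancedSequence H d N) {k m : ℕ} (hm : k ≤ m) (hm' : m ≤ H + 3) :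
    moveCost d N k k - (if k = H + 2 then 1 / 6 else 0) ≤ moveCost d N k m := by
  obtain rfl | h : m = H + 3 ∨ m ≤ H + 2 := by omega
  · obtain rfl | rfl | hk : k = H + 3 ∨ k = H + 2 ∨ k ≤ H + 1 := by omega
    · simp
    · rw [if_pos rfl, moveCost_succ (H + 2) (H + 2), hB.deg_one, hB.deg_bot, hB.size_bot,
        hB.size_one]
      linarith
    · rw [if_neg (by omega)]
      have h1 := hB.moveCost_le_of_le hk (by omega)
      have h2 := hB.size_antitone hk (by omega)
      rw [hB.size_two] at h2
      rw [moveCost_succ, moveCost_succ, hB.deg_two, hB.deg_one, hB.deg_bot, hB.size_bot,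
        hB.size_one]
      have : 0 ≤ 2 / (2 + N k) + 1 / (1 + N k) - 2 / N k := by
        have : 2 / (2 + N k) + 1 / (1 + N k) - 2 / N k =
            (N k ^ 2 - 2 * N k - 4) / (N k * (1 + N k) * (2 + N k)) := by
          field_simp
          ring
        rw [this]
        apply div_nonneg
        · nlinarith
        · positivity
      have e : (2 - 1) / N k + (1 - 0) / N k = 2 / N k := by ring
      linarith
  · have := hB.moveCost_le_of_le hm h
    split_ifs <;> linarith

lemma pathCost_le_moveCost (hB : BalancedSequence H d N) {k m : ℕ} (hk : k < H + 3)
    (hm : m ≤ H + 3) :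
    ∑ i ∈ Finset.range (k + 1), d i / N (i + 1) ≤ moveCost d N (k + 1) m := by
  have n1 := hB.one_le_size (i := k + 1) (by omega)
  have e : ∑ i ∈ Finset.range (k + 1), d i / N (i + 1) =
      moveCost d N (k + 1) k + (N (k + 1) * pathGain d N k - 1) / N (k + 1) := by
    rw [pathGain, Finset.sum_sub_distrib, moveCost, Finset.sum_range_succ]
    field_simp
    ring
  obtain hmk | hmk := le_or_gt m k
  · refine le_trans ?_ (hB.moveCost_le_of_lt hmk hk)
    have hP : N (k + 1) * pathGain d N k ≤ 1 := by
      obtain h | rfl | rfl | rfl : k < H ∨ k = H ∨ k = H + 1 ∨ k = H + 2 := by omega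
      · linarith [hB.pathGain_of_lt h]
      · exact hB.pathGain_three
      · linarith [hB.pathGain_two]
      · linarith [hB.pathGain_one]
    have := div_nonpos_of_nonpos_of_nonneg (sub_nonpos.2 hP) (zero_le_one.trans n1)
    linarith
  · refine le_trans ?_ (hB.moveCost_self_le (show k + 1 ≤ m from hmk) hm)
    have e2 : moveCost d N (k + 1) (k + 1) = moveCost d N (k + 1) k +
        (d (k + 1) - d k / 2) / N (k + 1) := by
      rw [moveCost_succ]
      field_simp
      ring
    rw [e, e2]
    obtain h | rfl | rfl | rfl : k < H ∨ k = H ∨ k = H + 1 ∨ k = H + 2 := by omega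
    · rw [if_neg (by omega), sub_zero]
      gcongr _ + ?_ / _
      linarith [hB.pathGain_of_lt h, hB.deg_le' k h]
    · rw [if_neg (by omega), sub_zero]
      gcongr _ + ?_ / _
      linarith [hB.pathGain_three, hB.deg_three, hB.deg_two]
    · rw [if_pos rfl, hB.deg_two, hB.deg_one]
      have := hB.pathGain_two
      rw [hB.size_one] at this ⊢
      linarith
    · rw [if_neg (by omega), sub_zero]
      gcongr _ + ?_ / _
      linarith [hB.pathGain_one, hB.deg_one, hB.deg_bot]

lemma deg_div_size_le (hB : BalancedSequence H d N) {k m : ℕ} (hkm : k < m) (hm : m ≤ H + 3) :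
    d k / N (k + 1) ≤ (d m + 1) / N (k + 1) + (d k - 1) / (N (k + 1) + N (k + 1)) +
      ∑ i ∈ Finset.Ico (k + 1) m, d i / (N (i + 1) + N (k + 1)) := by
  have n1 := hB.one_le_size (i := k + 1) (by omega)
  have h := hB.moveCost_self_le (show k + 1 ≤ m from hkm) hm
  rw [moveCost, moveCost, ← Finset.sum_range_add_sum_Ico _ (show k + 1 ≤ m from hkm)] at h
  suffices d k / N (k + 1) ≤ (d (k + 1) + 1) / N (k + 1) + (d k - 1) / (N (k + 1) + N (k + 1)) -
      (if k + 1 = H + 2 then 1 / 6 else 0) by linarith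
  have e : (d k - 1) / (N (k + 1) + N (k + 1)) = (d k - 1) / 2 / N (k + 1) := by
    field_simp
    ring
  rw [e, ← add_div]
  obtain h | rfl | rfl | rfl : k < H ∨ k = H ∨ k = H + 1 ∨ k = H + 2 := by omega
  · rw [if_neg (by omega), sub_zero]
    gcongr
    linarith [hB.deg_le' k h]
  · rw [if_neg (by omega), sub_zero]
    gcongr
    linarith [hB.deg_three, hB.deg_two]
  · rw [if_pos rfl, hB.deg_two, hB.deg_one, hB.size_one]
    norm_num
  · rw [if_neg (by omega), sub_zero]
    gcongr
    linarith [hB.deg_one, hB.deg_bot]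

end BalancedSequence

section Tree

variable {s : Fin (n + 1) → Fin (n + 1)} {v w : Fin (n + 1)}

/-- The distance from `v` to the root `0`. -/
def level (s : Fin (n + 1) → Fin (n + 1)) (v : Fin (n + 1)) : ℕ :=
  sInf {k | s^[k] v = 0}

lemma iterate_level (hreach : ∀ v, ∃ k, s^[k] v = 0) (v : Fin (n + 1)) :
    s^[level s v] v = 0 :=
  Nat.sInf_mem (s := {k | s^[k] v = 0}) (hreach v)

lemma iterate_ne_zero {j : ℕ} (hj : j < level s v) : s^[j] v ≠ 0 :=
  Nat.notMem_of_lt_sInf hj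

lemma level_eq {k : ℕ} (h : s^[k] v = 0) (h' : ∀ j < k, s^[j] v ≠ 0) : level s v = k := by
  refine le_antisymm (Nat.sInf_le h) (not_lt.1 fun hlt => h' _ hlt ?_)
  exact Nat.sInf_mem (s := {k | s^[k] v = 0}) ⟨k, h⟩

lemma level_zero : level s 0 = 0 := level_eq rfl (by simp)

lemma level_pos (hreach : ∀ v, ∃ k, s^[k] v = 0) (hv : v ≠ 0) : 0 < level s v := by
  refine Nat.pos_of_ne_zero fun h => hv ?_
  simpa [h] using iterate_level hreach v

lemma level_apply (hreach : ∀ v, ∃ k, s^[k] v = 0) (hv : v ≠ 0) :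
    level s (s v) + 1 = level s v := by
  refine (level_eq ?_ ?_).symm
  · rw [iterate_succ_apply, iterate_level hreach]
  · rintro (_ | j) hj
    · exact hv
    · rw [iterate_succ_apply]
      exact iterate_ne_zero (by omega)

lemma level_iterate (hr : s 0 = 0) (hreach : ∀ v, ∃ k, s^[k] v = 0) (v : Fin (n + 1)) (j : ℕ) :
    level s (s^[j] v) = level s v - j := by
  induction j with
  | zero => simp
  | succ j ih =>
    rw [iterate_succ_apply']
    by_cases h : s^[j] v = 0
    · rw [h, level_zero] at ih
      rw [h, hr, level_zero]
      omega
    · have := level_apply hreach h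
      omega

lemma eq_iterate_sub_level (hr : s 0 = 0) (hreach : ∀ v, ∃ k, s^[k] v = 0) {k : ℕ}
    (h : s^[k] w = v) : v = s^[level s w - level s v] w := by
  have hl := level_iterate hr hreach w k
  rw [h] at hl
  obtain hk | hk := le_or_gt k (level s w)
  · rw [hl, Nat.sub_sub_self hk, h]
  · have h0 : level s v = 0 := by omega
    have hv : v = 0 := by simpa [h0] using iterate_level hreach v
    rw [h0, hv, Nat.sub_zero, iterate_level hreach]

/-- The set of nodes having a directed path to `u`. -/
def subtree (s : Fin (n + 1) → Fin (n + 1)) (u : Fin (n + 1)) : Finset (Fin (n + 1)) :=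
  Finset.univ.filter fun w => ∃ k, s^[k] w = u

/-- The set of agents whose chosen node is `v`. -/
def children (s : Fin (n + 1) → Fin (n + 1)) (v : Fin (n + 1)) : Finset (Fin (n + 1)) :=
  Finset.univ.filter fun u => u ≠ 0 ∧ s u = v

lemma mem_subtree : w ∈ subtree s v ↔ ∃ k, s^[k] w = v := by simp [subtree]

lemma mem_children : w ∈ children s v ↔ w ≠ 0 ∧ s w = v := by simp [children]

lemma subtreeSize_eq (s : Fin (n + 1) → Fin (n + 1)) (u : Fin (n + 1)) :
    subtreeSize s u = (subtree s u).card :=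
  Nat.subtype_card _ fun _ => mem_subtree

lemma indeg_eq (s : Fin (n + 1) → Fin (n + 1)) (u : Fin (n + 1)) :
    indeg 0 s u = (children s u).card :=
  Nat.subtype_card _ fun _ => mem_children

lemma self_mem_subtree (s : Fin (n + 1) → Fin (n + 1)) (u : Fin (n + 1)) : u ∈ subtree s u :=
  mem_subtree.2 ⟨0, rfl⟩

lemma subtree_subset (h : v ∈ subtree s w) : subtree s v ⊆ subtree s w := by
  obtain ⟨j, hj⟩ := mem_subtree.1 h
  intro x hx
  obtain ⟨i, hi⟩ := mem_subtree.1 hx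
  exact mem_subtree.2 ⟨j + i, by rw [iterate_add_apply, hi, hj]⟩

lemma subtreeSize_pos (s : Fin (n + 1) → Fin (n + 1)) (u : Fin (n + 1)) : 0 < subtreeSize s u := by
  rw [subtreeSize_eq]
  exact Finset.card_pos.2 ⟨u, self_mem_subtree s u⟩

lemma subtree_eq (hr : s 0 = 0) (v : Fin (n + 1)) :
    subtree s v = insert v ((children s v).biUnion (subtree s)) := by
  ext w
  rw [Finset.mem_insert, Finset.mem_biUnion]
  constructor
  · rw [mem_subtree]
    rintro ⟨k, hk⟩
    induction k with
    | zero => exact Or.inl hk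
    | succ k ih =>
      by_cases h0 : s^[k] w = 0
      · exact ih (by rw [← hk, iterate_succ_apply', h0, hr])
      · exact Or.inr ⟨s^[k] w, mem_children.2 ⟨h0, by rw [← hk, iterate_succ_apply']⟩,
          mem_subtree.2 ⟨k, rfl⟩⟩
  · rintro (rfl | ⟨u, hu, hw⟩)
    · exact self_mem_subtree s w
    · exact subtree_subset (mem_subtree.2 ⟨1, (mem_children.1 hu).2⟩) hw

lemma subtreeSize_eq_sum (hr : s 0 = 0) (hreach : ∀ v, ∃ k, s^[k] v = 0) (v : Fin (n + 1)) :
    subtreeSize s v = 1 + ∑ u ∈ children s v, subtreeSize s u := by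
  have hlev : ∀ u ∈ children s v, level s u = level s v + 1 := fun u hu => by
    rw [← level_apply hreach (mem_children.1 hu).1, (mem_children.1 hu).2]
  rw [subtreeSize_eq, subtree_eq hr, Finset.card_insert_of_notMem, Finset.card_biUnion]
  · simp_rw [subtreeSize_eq]
    rw [add_comm]
  · intro u hu u' hu' hne
    refine Finset.disjoint_left.2 ?_
    intro w hw hw'
    obtain ⟨k, hk⟩ := mem_subtree.1 hw
    obtain ⟨k', hk'⟩ := mem_subtree.1 hw'
    apply hne
    rw [eq_iterate_sub_level hr hreach hk, eq_iterate_sub_level hr hreach hk', hlev u hu,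
      hlev u' hu']
  · rw [Finset.mem_biUnion]
    rintro ⟨u, hu, hw⟩
    obtain ⟨k, hk⟩ := mem_subtree.1 hw
    have h1 := level_iterate hr hreach v k
    rw [hk, hlev u hu] at h1
    omega

/-- The size of a subtree rooted at distance `i` from the root in a balanced tree of height `h`
with degrees `d`. -/
def balancedSize (d : ℕ → ℕ) (h i : ℕ) : ℕ :=
  if i < h then 1 + d i * balancedSize d h (i + 1) else 1
termination_by h - i

lemma subtreeSize_eq_balancedSize {d : ℕ → ℕ} {h : ℕ} (hr : s 0 = 0) (hh : ∀ v, s^[h] v = 0)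
    (hdeg : ∀ v, indeg 0 s v = d (level s v)) (hd : d h = 0) (v : Fin (n + 1)) :
    subtreeSize s v = balancedSize d h (level s v) := by
  have hreach : ∀ v, ∃ k, s^[k] v = 0 := fun v => ⟨h, hh v⟩
  have hle : ∀ v, level s v ≤ h := fun v => Nat.sInf_le (hh v)
  have H : ∀ i ≤ h, ∀ v, level s v = i → subtreeSize s v = balancedSize d h i := by
    intro i hi
    induction hi using Nat.decreasingInduction with
    | self =>
      intro v hv
      have h0 := hdeg v
      rw [hv, hd, indeg_eq, Finset.card_eq_zero] at h0
      rw [subtreeSize_eq_sum hr hreach, h0, balancedSize, if_neg (lt_irrefl h)]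
      simp
    | of_succ i hi ih =>
      intro v hv
      rw [subtreeSize_eq_sum hr hreach, balancedSize, if_pos hi,
        Finset.sum_congr rfl fun u hu => ih u ?_, Finset.sum_const, ← indeg_eq, hdeg, hv,
        smul_eq_mul]
      rw [← level_apply hreach (mem_children.1 hu).1, (mem_children.1 hu).2, hv]
  exact H _ (hle v) v rfl

lemma cost_eq {k : ℕ} (h : s^[k] v = 0) (h' : ∀ j < k, s^[j] v ≠ 0) :
    cost 0 s v = ∑ j ∈ Finset.range k,
      (indeg 0 s (s^[j + 1] v) : ℝ≥0∞) / (subtreeSize s (s^[j] v) : ℝ≥0∞) := by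
  have hk : ∃ k, s^[k] v = 0 := ⟨k, h⟩
  rw [cost, dif_pos hk, (Nat.find_eq_iff hk).2 ⟨h, h'⟩]

lemma ofReal_div_le {a b : ℕ} {x y : ℝ} (hb : 0 < b) (hx : x ≤ a) (hy : (b : ℝ) ≤ y) :
    ENNReal.ofReal (x / y) ≤ (a : ℝ≥0∞) / (b : ℝ≥0∞) := by
  have hb' : (0 : ℝ) < b := by exact_mod_cast hb
  rw [← ENNReal.ofReal_natCast a, ← ENNReal.ofReal_natCast b, ← ENNReal.ofReal_div_of_pos hb']
  apply ENNReal.ofReal_le_ofReal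
  gcongr

lemma ofReal_natCast_div {a b : ℕ} (hb : 0 < b) :
    (a : ℝ≥0∞) / (b : ℝ≥0∞) = ENNReal.ofReal ((a : ℝ) / b) := by
  have hb' : (0 : ℝ) < b := by exact_mod_cast hb
  rw [ENNReal.ofReal_div_of_pos hb', ENNReal.ofReal_natCast, ENNReal.ofReal_natCast]

/-- The cost of an agent in a balanced tree. -/
lemma cost_eq_ofReal (hr : s 0 = 0) (hreach : ∀ v, ∃ k, s^[k] v = 0) {d N : ℕ → ℕ}
    (hdeg : ∀ v, indeg 0 s v = d (level s v)) (hsize : ∀ v, subtreeSize s v = N (level s v))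
    (v : Fin (n + 1)) :
    cost 0 s v =
      ENNReal.ofReal (∑ i ∈ Finset.range (level s v), (d i : ℝ) / (N (i + 1) : ℝ)) := by
  rw [cost_eq (iterate_level hreach v) fun _ => iterate_ne_zero,
    ENNReal.ofReal_sum_of_nonneg fun i _ => by positivity, ← Finset.sum_range_reflect]
  refine Finset.sum_congr rfl fun i hi => ?_
  rw [Finset.mem_range] at hi
  rw [ofReal_natCast_div (subtreeSize_pos _ _), hdeg, hsize, level_iterate hr hreach,
    level_iterate hr hreach]
  congr <;> omega

section Deviation

lemma iterate_ne_of_update_reaches (hr : s 0 = 0) (hv : v ≠ 0)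
    (h : ∃ k, (update s v w)^[k] v = 0) (j : ℕ) : s^[j] w ≠ v := by
  intro hj
  have hex : ∃ j, s^[j] w = v := ⟨j, hj⟩
  obtain ⟨j, hj, hmin⟩ : ∃ j, s^[j] w = v ∧ ∀ i < j, s^[i] w ≠ v :=
    ⟨Nat.find hex, Nat.find_spec hex, fun _ => Nat.find_min hex⟩
  have hagree : ∀ i ≤ j, (update s v w)^[i] w = s^[i] w := by
    intro i hi
    induction i with
    | zero => rfl
    | succ i ih =>
      rw [iterate_succ_apply', iterate_succ_apply', ih (by omega),
        update_of_ne (hmin i (by omega))]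
  have hper : IsPeriodicPt (update s v w) (j + 1) v := by
    change (update s v w)^[j + 1] v = v
    rw [iterate_succ_apply, update_self, hagree j le_rfl, hj]
  obtain ⟨k, hk⟩ := h
  have h1 := hper.const_mul k
  rw [IsPeriodicPt, IsFixedPt, Nat.mul_succ, iterate_add_apply, hk,
    iterate_fixed (by rw [update_of_ne hv.symm, hr])] at h1
  exact hv h1.symm

lemma update_iterate_succ (hw : ∀ j, s^[j] w ≠ v) (j : ℕ) :
    (update s v w)^[j + 1] v = s^[j] w := by
  rw [iterate_succ_apply, update_self]
  induction j with
  | zero => rfl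
  | succ j ih => rw [iterate_succ_apply', ih, update_of_ne (hw j), iterate_succ_apply']

lemma cost_update (hreach : ∀ v, ∃ k, s^[k] v = 0) (hv : v ≠ 0) (hw : ∀ j, s^[j] w ≠ v) :
    cost 0 (update s v w) v =
      ∑ j ∈ Finset.range (level s w), (indeg 0 (update s v w) (s^[j + 1] w) : ℝ≥0∞) /
        (subtreeSize (update s v w) (s^[j] w) : ℝ≥0∞) +
      (indeg 0 (update s v w) w : ℝ≥0∞) / (subtreeSize (update s v w) v : ℝ≥0∞) := by
  rw [cost_eq (k := level s w + 1), Finset.sum_range_succ']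
  · simp_rw [update_iterate_succ hw]
    rfl
  · rw [update_iterate_succ hw, iterate_level hreach]
  · rintro (_ | j) hj
    · exact hv
    · rw [update_iterate_succ hw]
      exact iterate_ne_zero (by omega)

lemma subtree_update_subset (s : Fin (n + 1) → Fin (n + 1)) (v w u : Fin (n + 1)) :
    subtree (update s v w) u ⊆ subtree s u ∪ subtree s v := by
  intro x hx
  obtain ⟨k, hk⟩ := mem_subtree.1 hx
  clear hx
  rw [Finset.mem_union]
  induction k generalizing x with
  | zero => exact Or.inl (mem_subtree.2 ⟨0, hk⟩)
  | succ k ih =>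
    by_cases hxv : x = v
    · exact Or.inr (hxv ▸ self_mem_subtree s x)
    · rw [iterate_succ_apply, update_of_ne hxv] at hk
      have hx : x ∈ subtree s (s x) := mem_subtree.2 ⟨1, rfl⟩
      exact (ih hk).imp (fun h => subtree_subset h hx) fun h => subtree_subset h hx

lemma subtreeSize_update_le_add (s : Fin (n + 1) → Fin (n + 1)) (v w u : Fin (n + 1)) :
    subtreeSize (update s v w) u ≤ subtreeSize s u + subtreeSize s v := by
  simp_rw [subtreeSize_eq]
  exact (Finset.card_le_card (subtree_update_subset s v w u)).trans (Finset.card_union_le _ _)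

lemma subtreeSize_update_le {u : Fin (n + 1)} (h : v ∈ subtree s u) :
    subtreeSize (update s v w) u ≤ subtreeSize s u := by
  simp_rw [subtreeSize_eq]
  refine Finset.card_le_card ((subtree_update_subset s v w u).trans ?_)
  exact Finset.union_subset le_rfl (subtree_subset h)

lemma indeg_le_indeg_update_add_one (s : Fin (n + 1) → Fin (n + 1)) (v w u : Fin (n + 1)) :
    indeg 0 s u ≤ indeg 0 (update s v w) u + 1 := by
  simp_rw [indeg_eq]
  have h : (children s u).erase v ⊆ children (update s v w) u := by
    intro x hx
    obtain ⟨hxv, hx⟩ := Finset.mem_erase.1 hx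
    rw [mem_children, update_of_ne hxv]
    exact mem_children.1 hx
  have h1 := Finset.card_le_card h
  have h2 := Finset.pred_card_le_card_erase (s := children s u) (a := v)
  omega

lemma indeg_le_indeg_update {u : Fin (n + 1)} (hu : u ≠ s v) :
    indeg 0 s u ≤ indeg 0 (update s v w) u := by
  simp_rw [indeg_eq]
  refine Finset.card_le_card fun x hx => ?_
  have hxv : x ≠ v := by
    rintro rfl
    exact hu (mem_children.1 hx).2.symm
  rw [mem_children, update_of_ne hxv]
  exact mem_children.1 hx

lemma indeg_add_one_le_indeg_update (hv : v ≠ 0) (hw : w ≠ s v) :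
    indeg 0 s w + 1 ≤ indeg 0 (update s v w) w := by
  simp_rw [indeg_eq]
  have hvw : v ∉ children s w := fun h => hw (mem_children.1 h).2.symm
  rw [← Finset.card_insert_of_notMem hvw]
  refine Finset.card_le_card fun x hx => ?_
  obtain rfl | hx := Finset.mem_insert.1 hx
  · exact mem_children.2 ⟨hv, update_self ..⟩
  · have hxv : x ≠ v := fun h => hvw (h ▸ hx)
    rw [mem_children, update_of_ne hxv]
    exact mem_children.1 hx

lemma ofReal_le_cost_update (hreach : ∀ v, ∃ k, s^[k] v = 0) (hv : v ≠ 0)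
    (hw : ∀ j, s^[j] w ≠ v) {x : ℝ} {e : ℕ → ℝ}
    (hx : ENNReal.ofReal x ≤
      (indeg 0 (update s v w) w : ℝ≥0∞) / (subtreeSize (update s v w) v : ℝ≥0∞))
    (he0 : ∀ i < level s w, 0 ≤ e i)
    (he : ∀ j < level s w, ENNReal.ofReal (e (level s w - 1 - j)) ≤
      (indeg 0 (update s v w) (s^[j + 1] w) : ℝ≥0∞) /
        (subtreeSize (update s v w) (s^[j] w) : ℝ≥0∞)) :
    ENNReal.ofReal (x + ∑ i ∈ Finset.range (level s w), e i) ≤ cost 0 (update s v w) v := by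
  rw [cost_update hreach hv hw, add_comm x]
  refine ENNReal.ofReal_add_le.trans (add_le_add ?_ hx)
  rw [ENNReal.ofReal_sum_of_nonneg fun i hi => he0 i (Finset.mem_range.1 hi),
    ← Finset.sum_range_reflect]
  exact Finset.sum_le_sum fun j hj => he j (Finset.mem_range.1 hj)

end Deviation

lemma isStable_of_balancedSequence {H : ℕ} {d N : ℕ → ℕ} (hval : ValidProfile 0 s)
    (hh : ∀ v, s^[H + 3] v = 0) (hdeg : ∀ v, indeg 0 s v = d (level s v))
    (hsize : ∀ v, subtreeSize s v = N (level s v))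
    (hB : BalancedSequence H (fun i => (d i : ℝ)) fun i => (N i : ℝ)) : IsStable 0 s := by
  have hr := hval.1
  have hreach : ∀ v, ∃ k, s^[k] v = 0 := fun v => ⟨_, hh v⟩
  have hle : ∀ v, level s v ≤ H + 3 := fun v => Nat.sInf_le (hh v)
  refine ⟨hval, fun v hv w _ => ?_⟩
  by_cases hws : w = s v
  · rw [hws, update_eq_self]
  by_cases hex : ∃ k, (update s v w)^[k] v = 0
  swap
  · rw [cost.eq_def 0 (update s v w), dif_neg hex]
    exact le_top
  have hw := iterate_ne_of_update_reaches hr hv hex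
  rw [cost_eq_ofReal hr hreach hdeg hsize]
  obtain ⟨k, hk⟩ : ∃ k, level s v = k + 1 := ⟨level s v - 1, by have := level_pos hreach hv; omega⟩
  have hkH : k < H + 3 := by have := hle v; omega
  have hsv : level s (s v) = k := by have := level_apply hreach hv; omega
  have hx : ENNReal.ofReal ((d (level s w) + 1 : ℝ) / N (k + 1)) ≤
      (indeg 0 (update s v w) w : ℝ≥0∞) / (subtreeSize (update s v w) v : ℝ≥0∞) := by
    refine ofReal_div_le (subtreeSize_pos _ _) ?_ ?_
    · rw [← hdeg]
      exact_mod_cast indeg_add_one_le_indeg_update hv hws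
    · rw [← hk, ← hsize]
      exact_mod_cast subtreeSize_update_le (self_mem_subtree s v)
  have hlev : ∀ j < level s w, level s (s^[j] w) = level s w - 1 - j + 1 ∧
      level s (s^[j + 1] w) = level s w - 1 - j := fun j hj => by
    rw [level_iterate hr hreach, level_iterate hr hreach]
    omega
  have hadd : ∀ j < level s w, (subtreeSize (update s v w) (s^[j] w) : ℝ) ≤
      N (level s w - 1 - j + 1) + N (k + 1) := fun j hj => by
    rw [← hk, ← (hlev j hj).1, ← hsize, ← hsize]
    exact_mod_cast subtreeSize_update_le_add s v w _
  rw [hk]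
  by_cases hanc : ∃ j < level s w, s^[j + 1] w = s v
  · obtain ⟨j₀, hj₀, hj₀v⟩ := hanc
    have hj₀k := (hlev j₀ hj₀).2
    rw [hj₀v, hsv] at hj₀k
    have hkm : k < level s w := by omega
    have hdk : (1 : ℝ) ≤ d k := hB.one_le_deg hkH
    have hne : ∀ j < level s w, level s w - 1 - j ≠ k → s^[j + 1] w ≠ s v := fun j hj h h' =>
      h (by rw [← (hlev j hj).2, h', hsv])
    let e : ℕ → ℝ := fun i =>
      if i < k then (d i : ℝ) / N (i + 1)
      else if i = k then ((d k : ℝ) - 1) / (N (k + 1) + N (k + 1))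
      else (d i : ℝ) / (N (i + 1) + N (k + 1))
    refine le_trans (ENNReal.ofReal_le_ofReal ?_)
      (ofReal_le_cost_update hreach hv hw (e := e) hx (fun i _ => ?_) fun j hj => ?_)
    · rw [← Finset.sum_range_add_sum_Ico e (show k + 1 ≤ level s w from hkm),
        Finset.sum_range_succ, Finset.sum_range_succ]
      have e1 : ∑ i ∈ Finset.range k, e i = ∑ i ∈ Finset.range k, (d i : ℝ) / N (i + 1) :=
        Finset.sum_congr rfl fun i hi => if_pos (Finset.mem_range.1 hi)
      have e2 : ∑ i ∈ Finset.Ico (k + 1) (level s w), e i =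
          ∑ i ∈ Finset.Ico (k + 1) (level s w), (d i : ℝ) / (N (i + 1) + N (k + 1)) :=
        Finset.sum_congr rfl fun i hi => by
          have := Finset.mem_Ico.1 hi
          simp only [e]
          rw [if_neg (by omega), if_neg (by omega)]
      have e3 : e k = ((d k : ℝ) - 1) / (N (k + 1) + N (k + 1)) := by simp [e]
      rw [e1, e2, e3]
      linarith [hB.deg_div_size_le hkm (hle w)]
    · have : (0 : ℝ) ≤ (d k : ℝ) - 1 := by linarith
      simp only [e]
      split_ifs <;> positivity
    · simp only [e]
      split_ifs with h1 h2
      · have hvj : s^[j - j₀] v = s^[j] w := by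
          rw [show j - j₀ = j - j₀ - 1 + 1 by omega, iterate_succ_apply, ← hj₀v,
            ← iterate_add_apply]
          congr 2
          omega
        refine ofReal_div_le (subtreeSize_pos _ _) ?_ ?_
        · rw [← (hlev j hj).2, ← hdeg]
          exact_mod_cast indeg_le_indeg_update (hne j hj h1.ne)
        · rw [← (hlev j hj).1, ← hsize]
          exact_mod_cast subtreeSize_update_le (mem_subtree.2 ⟨_, hvj⟩)
      · refine ofReal_div_le (subtreeSize_pos _ _) ?_ (h2 ▸ hadd j hj)
        rw [sub_le_iff_le_add, ← h2, ← (hlev j hj).2, ← hdeg]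
        exact_mod_cast indeg_le_indeg_update_add_one s v w _
      · refine ofReal_div_le (subtreeSize_pos _ _) ?_ (hadd j hj)
        rw [← (hlev j hj).2, ← hdeg]
        exact_mod_cast indeg_le_indeg_update (hne j hj h2)
  · push Not at hanc
    refine le_trans (ENNReal.ofReal_le_ofReal (hB.pathCost_le_moveCost hkH (hle w)))
      (ofReal_le_cost_update hreach hv hw hx (fun i _ => by positivity) fun j hj => ?_)
    refine ofReal_div_le (subtreeSize_pos _ _) ?_ (hadd j hj)
    beta_reduce
    rw [← (hlev j hj).2, ← hdeg]
    exact_mod_cast indeg_le_indeg_update (hanc j hj)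

end Tree

section Existence

/-- A node of the tree with degrees `d`, encoded by the list of the positions among their siblings
of the nodes on the path to the root. -/
def IsBranch (d : ℕ → ℕ) : List ℕ → Prop
  | [] => True
  | x :: t => x < d t.length ∧ IsBranch d t

variable {d : ℕ → ℕ} {h : ℕ}

lemma IsBranch.length_le (hd : d h = 0) : ∀ {l : List ℕ}, IsBranch d l → l.length ≤ h
  | [], _ => Nat.zero_le _
  | x :: t, hl => by
    have h1 := hl.2.length_le hd
    have h2 : t.length ≠ h := fun heq => by
      have h3 := hl.1
      rw [heq, hd] at h3
      omega
    rw [List.length_cons]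
    omega

lemma IsBranch.tail : ∀ {l : List ℕ}, IsBranch d l → IsBranch d l.tail
  | [], hl => hl
  | _ :: _, hl => hl.2

lemma finite_isBranch (hd : d h = 0) : {l | IsBranch d l}.Finite := by
  have hfin : ∀ k, {l | IsBranch d l ∧ l.length = k}.Finite := by
    intro k
    induction k with
    | zero =>
      refine (Set.finite_singleton []).subset fun l hl => ?_
      exact List.length_eq_zero_iff.1 hl.2
    | succ k ih =>
      refine (((Set.finite_Iio (d k)).prod ih).image fun p => p.1 :: p.2).subset ?_
      rintro (_ | ⟨x, t⟩) ⟨hl, hk⟩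
      · simp at hk
      · have ht : t.length = k := by simpa using hk
        exact ⟨(x, t), ⟨by simpa [← ht] using hl.1, hl.2, ht⟩, rfl⟩
  refine ((Set.finite_Iic h).biUnion fun k _ => hfin k).subset fun l hl => ?_
  simp only [Set.mem_iUnion]
  exact ⟨l.length, IsBranch.length_le hd hl, hl, rfl⟩

/-- The parent map of the tree with degrees `d`. -/
def branchParent (l : {l // IsBranch d l}) : {l // IsBranch d l} := ⟨l.1.tail, l.2.tail⟩

lemma coe_branchParent_iterate (l : {l // IsBranch d l}) (k : ℕ) :
    (branchParent^[k] l).1 = l.1.drop k := by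
  induction k with
  | zero => rfl
  | succ k ih =>
    rw [iterate_succ_apply', ← List.tail_drop, ← ih]
    rfl

lemma exists_balanced (hd : d h = 0) : ∃ (n : ℕ) (s : Fin (n + 1) → Fin (n + 1)),
    ValidProfile 0 s ∧ (∀ v, s^[h] v = 0) ∧ ∀ v, indeg 0 s v = d (level s v) := by
  have : Finite {l // IsBranch d l} := finite_isBranch hd
  let root : {l // IsBranch d l} := ⟨[], trivial⟩
  have : Nonempty {l // IsBranch d l} := ⟨root⟩
  obtain ⟨n, hn⟩ : ∃ n, Nat.card {l // IsBranch d l} = n + 1 :=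
    ⟨_, (Nat.succ_pred_eq_of_pos Nat.card_pos).symm⟩
  obtain ⟨e, he⟩ : ∃ e : {l // IsBranch d l} ≃ Fin (n + 1), e root = 0 :=
    ⟨(Finite.equivFinOfCardEq hn).trans (Equiv.swap (Finite.equivFinOfCardEq hn root) 0), by simp⟩
  let s : Fin (n + 1) → Fin (n + 1) := fun v => e (branchParent (e.symm v))
  have hiter : ∀ k v, s^[k] v = e (branchParent^[k] (e.symm v)) := by
    intro k v
    have hsc : Semiconj e branchParent s := fun l => by simp [s]
    rw [(hsc.iterate_right k).eq, e.apply_symm_apply]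
  have hzero : ∀ k v, s^[k] v = 0 ↔ (e.symm v).1.length ≤ k := by
    intro k v
    rw [hiter, ← he, e.injective.eq_iff, Subtype.ext_iff, coe_branchParent_iterate,
      List.drop_eq_nil_iff]
  have hlevel : ∀ v, level s v = (e.symm v).1.length := fun v =>
    level_eq ((hzero _ v).2 le_rfl) fun j hj h0 => by
      have := (hzero _ v).1 h0
      omega
  refine ⟨n, s, ⟨?_, fun v hv hsv => hv ?_⟩, fun v => ?_, fun v => ?_⟩
  · simp [s, ← he, root, branchParent]
  · refine (hzero 0 v).2 ?_
    have h1 : (branchParent (e.symm v)).1.length = (e.symm v).1.length := by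
      conv_rhs => rw [← hsv, e.symm_apply_apply]
    rw [branchParent, List.length_tail] at h1
    omega
  · exact (hzero _ v).2 ((e.symm v).2.length_le hd)
  · rw [hlevel, indeg_eq]
    let f : Fin (d (e.symm v).1.length) → Fin (n + 1) := fun x =>
      e ⟨x.1 :: (e.symm v).1, x.2, (e.symm v).2⟩
    have hf : Injective f := fun x y hxy => by
      have := congrArg Subtype.val (e.injective hxy)
      exact Fin.ext (List.cons.inj this).1
    have himage : children s v = Finset.univ.image f := by
      ext u
      rw [mem_children, Finset.mem_image]
      constructor
      · rintro ⟨hu, hsu⟩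
        have hp : branchParent (e.symm u) = e.symm v := by rw [← hsu, e.symm_apply_apply]
        obtain ⟨l, hl⟩ : ∃ l, e.symm u = l := ⟨_, rfl⟩
        rw [hl] at hp
        obtain ⟨_ | ⟨x, t⟩, ht⟩ := l
        · exact absurd ((e.symm_apply_eq.1 hl).trans he) hu
        · have htv : t = (e.symm v).1 := congrArg Subtype.val hp
          refine ⟨⟨x, htv ▸ ht.1⟩, Finset.mem_univ _, ?_⟩
          rw [e.symm_apply_eq.1 hl]
          exact congrArg e (Subtype.ext (congrArg (List.cons x) htv.symm))
      · rintro ⟨x, -, rfl⟩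
        refine ⟨fun h0 => ?_, ?_⟩
        · have := (hzero 0 (f x)).1 h0
          simp [f] at this
        · simp [s, f, branchParent]
    rw [himage, Finset.card_image_of_injective _ hf, Finset.card_univ, Fintype.card_fin]

end Existence

lemma isStable_of_balanced {H : ℕ} {d : ℕ → ℕ} {s : Fin (n + 1) → Fin (n + 1)}
    (hval : ValidProfile 0 s) (hh : ∀ v, s^[H + 3] v = 0)
    (hdeg : ∀ v, indeg 0 s v = d (level s v)) (h0 : d (H + 3) = 0) (h1 : d (H + 2) = 1)
    (h2 : d (H + 1) = 2) (h3 : d H = 4)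
    (hd : ∀ j < H, d (j + 1) < d j ∧ d j ≤ 2 * d (j + 1) + 1) : IsStable 0 s := by
  refine isStable_of_balancedSequence (d := d) (N := balancedSize d (H + 3)) hval hh hdeg
    (subtreeSize_eq_balancedSize hval.1 hh hdeg h0) ?_
  refine ⟨by simp [h0], by simp [h1], by simp [h2], by simp [h3],
    fun i hi => by exact_mod_cast (hd i hi).1, fun i hi => by exact_mod_cast (hd i hi).2, ?_,
    fun i hi => ?_⟩
  · rw [balancedSize, if_neg (lt_irrefl _), Nat.cast_one]
  · rw [balancedSize, if_pos hi]
    push_cast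
    rfl

lemma iterate_height {s : Fin (n + 1) → Fin (n + 1)} (hr : s 0 = 0)
    (hreach : ∀ v, ∃ k, s^[k] v = 0) (v : Fin (n + 1)) : s^[height s] v = 0 := by
  refine Nat.sInf_mem (s := {k | ∀ v, s^[k] v = 0}) ⟨Finset.univ.sup (level s), fun v => ?_⟩ v
  have hle : level s v ≤ Finset.univ.sup (level s) := Finset.le_sup (Finset.mem_univ v)
  rw [← Nat.sub_add_cancel hle, iterate_add_apply, iterate_level hreach, iterate_fixed hr]

/-- Any balanced spanning tree of height `h` with degree sequence
`(0, 1, 2, 4, d_{h−4}, …, d_0)` such that `d_{j+1} < d_j ≤ 2·d_{j+1} + 1` for every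
`j ≤ h − 4` is stable; consequently the tree connection game admits a pure Nash
equilibrium for infinitely many numbers of agents `n`.  (A tree is balanced with degree
sequence `d` if every node at distance `k` from the root has in-degree `d k`.) -/
theorem balanced_trees_are_stable :
    (∀ (n h : ℕ) (d : ℕ → ℕ) (s : Fin (n + 1) → Fin (n + 1)),
      ValidProfile 0 s →
      (∀ v, ∃ k, s^[k] v = 0) →
      height s = h →
      (∀ (v : Fin (n + 1)) (k : ℕ), s^[k] v = 0 → (∀ j < k, s^[j] v ≠ 0) →
        indeg 0 s v = d k) →
      d h = 0 → d (h - 1) = 1 → d (h - 2) = 2 → d (h - 3) = 4 →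
      (∀ j, j ≤ h - 4 → d (j + 1) < d j ∧ d j ≤ 2 * d (j + 1) + 1) →
      IsStable 0 s) ∧
    {n : ℕ | ∃ s : Fin (n + 1) → Fin (n + 1), IsStable 0 s}.Infinite := by
  constructor
  · intro n h d s hval hreach hheight hdeg h0 h1 h2 h3 hd
    obtain ⟨H, rfl⟩ : ∃ H, h = H + 3 := by
      obtain hlt | hge := lt_or_ge h 3
      · interval_cases h <;> simp_all
      · exact ⟨h - 3, by omega⟩
    refine isStable_of_balanced hval (fun v => hheight ▸ iterate_height hval.1 hreach v)
      (fun v => hdeg v _ (iterate_level hreach v) fun _ => iterate_ne_zero) h0 h1 h2 h3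
      fun j hj => hd j (by omega)
  · refine Set.infinite_of_forall_exists_gt fun H => ?_
    let d : ℕ → ℕ := fun i => if i ≤ H then 4 + (H - i) else H + 3 - i
    have h0 : d (H + 3) = 0 := by simp [d]
    obtain ⟨n, s, hval, hh, hdeg⟩ := exists_balanced h0
    refine ⟨n, ⟨s, isStable_of_balanced hval hh hdeg h0 (by simp [d]) (by simp [d]) (by simp [d])
      fun j hj => ?_⟩, ?_⟩
    · simp only [d]
      rw [if_pos (show j + 1 ≤ H from hj), if_pos hj.le]
      omega
    · have hroot := hdeg 0
      rw [level_zero, indeg_eq] at hroot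
      have hcard := Finset.card_le_univ (children s 0)
      rw [hroot, Fintype.card_fin] at hcard
      simp only [d, Nat.zero_le, if_true] at hcard
      omega

end TCG
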